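/- There exist unique linear maps τ : V* → B and ρ : V* → V such that F = {(a + τ(α), (σ(a) + ρ(α), α)) : a ∈ A, α ∈ V*}. Moreover these maps satisfy 2⟨τ(α), a⟩ = −α(σ(a)) for all a ∈ A and α ∈ V*, and β(ρ(α)) = −α(ρ(β)) for all α, β ∈ V*. (This is the normal form of the generalized Dirac structure F obtained in Section 4.2 of the paper after choosing an isotropic complement B of A, fibrewise.) -/

import Mathlib

/-- The symmetric bilinear pairing on `E = 𝔻 × (V × V*)`:
`⟪(d₁,(u₁,α₁)),(d₂,(u₂,α₂))⟫ = ⟨d₁,d₂⟩ + (1/2)(α₁(u₂) + α₂(u₁))`. -/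
noncomputable def pairE {D V : Type*} [AddCommGroup D] [Module ℝ D] [AddCommGroup V] [Module ℝ V]
    (B : LinearMap.BilinForm ℝ D) (p q : D × V × Module.Dual ℝ V) : ℝ :=
  B p.1 q.1 + (1 / 2) * (p.2.2 q.2.1 + q.2.2 p.2.1)

/-- A Lagrangian subspace meeting `{0} × (V × {0})` trivially projects onto `V*`. -/
theorem exists_mem_of_lagrangian
    {D V : Type*} [AddCommGroup D] [Module ℝ D]
    [AddCommGroup V] [Module ℝ V] [FiniteDimensional ℝ V]
    (B : LinearMap.BilinForm ℝ D) (F : Submodule ℝ (D × V × Module.Dual ℝ V))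
    (hF : (F : Set (D × V × Module.Dual ℝ V)) =
      {e : D × V × Module.Dual ℝ V | ∀ f ∈ F, pairE B e f = 0})
    (hFi : ∀ u : V, ((0 : D), u, (0 : Module.Dual ℝ V)) ∈ F → u = 0)
    (α : Module.Dual ℝ V) : ∃ (d : D) (u : V), (d, u, α) ∈ F := by
  let P : Submodule ℝ (Module.Dual ℝ V) :=
    F.map (LinearMap.snd ℝ V (Module.Dual ℝ V) ∘ₗ LinearMap.snd ℝ D _)
  have hP : P.dualCoannihilator = ⊥ := by
    refine (Submodule.eq_bot_iff _).mpr fun u hu => hFi u ?_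
    rw [← SetLike.mem_coe, hF]
    intro f hf
    have hfu : f.2.2 u = 0 :=
      (Submodule.mem_dualCoannihilator u).mp hu _ (Submodule.mem_map_of_mem hf)
    simp [pairE, hfu]
  have hα : α ∈ P := by
    rw [← Subspace.dualCoannihilator_dualAnnihilator_eq (W := P), hP,
      Submodule.dualAnnihilator_bot]
    trivial
  obtain ⟨⟨d, u, β⟩, h, rfl⟩ := hα
  exact ⟨d, u, h⟩

theorem stmt
    {D V : Type*} [AddCommGroup D] [Module ℝ D] [FiniteDimensional ℝ D]
    [AddCommGroup V] [Module ℝ V] [FiniteDimensional ℝ V]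
    (B : LinearMap.BilinForm ℝ D) (hBsymm : B.IsSymm) (hBnd : B.Nondegenerate)
    (A : Submodule ℝ D)
    -- `A = A^⊥` (A is Lagrangian in 𝔻)
    (hA : (A : Set D) = {d : D | ∀ a ∈ A, B d a = 0})
    (F : Submodule ℝ (D × V × Module.Dual ℝ V))
    -- `F = F^⊥` with respect to the pairing `pairE B` (F is Lagrangian in E)
    (hF : (F : Set (D × V × Module.Dual ℝ V)) =
      {e : D × V × Module.Dual ℝ V | ∀ f ∈ F, pairE B e f = 0})
    -- (i) `F` intersects `{0} × (V × {0})` trivially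
    (hFi : ∀ u : V, ((0 : D), u, (0 : Module.Dual ℝ V)) ∈ F → u = 0)
    -- (ii) the image of `F ∩ (𝔻 × (V × {0}))` under the projection `E → 𝔻` equals `A`
    (hFii : ∀ d : D, d ∈ A ↔ ∃ u : V, (d, u, (0 : Module.Dual ℝ V)) ∈ F)
    -- `σ : A → V` assigns to each `a ∈ A` the (unique) `u` with `(a,(u,0)) ∈ F`
    (σ : A → V) (hσ : ∀ a : A, ((a : D), σ a, (0 : Module.Dual ℝ V)) ∈ F)
    -- `B₀` is an isotropic complement of `A` in `𝔻`
    (B₀ : Submodule ℝ D) (hB₀iso : ∀ b ∈ B₀, ∀ b' ∈ B₀, B b b' = 0)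
    (hcompl : IsCompl A B₀)
    :
    ∃ (τ : Module.Dual ℝ V →ₗ[ℝ] D) (ρ : Module.Dual ℝ V →ₗ[ℝ] V),
      (∀ α : Module.Dual ℝ V, τ α ∈ B₀) ∧
      (F : Set (D × V × Module.Dual ℝ V)) =
        {e : D × V × Module.Dual ℝ V |
          ∃ (a : A) (α : Module.Dual ℝ V), e = ((a : D) + τ α, σ a + ρ α, α)} ∧
      (∀ (α : Module.Dual ℝ V) (a : A), 2 * B (τ α) (a : D) = - α (σ a)) ∧
      (∀ α β : Module.Dual ℝ V, β (ρ α) = - α (ρ β)) ∧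
      -- uniqueness
      (∀ (τ' : Module.Dual ℝ V →ₗ[ℝ] D) (ρ' : Module.Dual ℝ V →ₗ[ℝ] V),
        (∀ α : Module.Dual ℝ V, τ' α ∈ B₀) →
        (F : Set (D × V × Module.Dual ℝ V)) =
          {e : D × V × Module.Dual ℝ V |
            ∃ (a : A) (α : Module.Dual ℝ V), e = ((a : D) + τ' α, σ a + ρ' α, α)} →
        τ' = τ ∧ ρ' = ρ) := by
  have uniq : ∀ (d : D) (u u' : V) (α : Module.Dual ℝ V),
      (d, u, α) ∈ F → (d, u', α) ∈ F → u = u' := by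
    intro d u u' α h h'
    have := F.sub_mem h h'
    simp only [Prod.mk_sub_mk, sub_self] at this
    exact sub_eq_zero.mp (hFi _ this)
  have uniq_of_mem : ∀ (b b' : D) (u u' : V) (α : Module.Dual ℝ V), b ∈ B₀ → b' ∈ B₀ →
      (b, u, α) ∈ F → (b', u', α) ∈ F → b = b' ∧ u = u' := by
    intro b b' u u' α hb hb' h h'
    have hsub := F.sub_mem h h'
    simp only [Prod.mk_sub_mk, sub_self] at hsub
    have hbb : b = b' := sub_eq_zero.mp <| Submodule.disjoint_def.mp hcompl.disjoint _
      ((hFii _).mpr ⟨_, hsub⟩) (B₀.sub_mem hb hb')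
    subst hbb
    exact ⟨rfl, uniq _ _ _ _ h h'⟩
  have isotropic : ∀ e ∈ F, ∀ f ∈ F, pairE B e f = 0 := by
    intro e he
    rw [← SetLike.mem_coe, hF] at he
    exact he
  have exists_mem := exists_mem_of_lagrangian B F hF hFi
  let p : (F ⊓ B₀.prod ⊤ : Submodule ℝ (D × V × Module.Dual ℝ V)) →ₗ[ℝ] Module.Dual ℝ V :=
    LinearMap.snd ℝ V (Module.Dual ℝ V) ∘ₗ LinearMap.snd ℝ D _ ∘ₗ Submodule.subtype _
  have hp : Function.Bijective p := by
    constructor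
    · intro ⟨⟨b, u, α⟩, h, hb, _⟩ ⟨⟨b', u', α'⟩, h', hb', _⟩ hα
      obtain rfl : α = α' := hα
      obtain ⟨rfl, rfl⟩ := uniq_of_mem b b' u u' α hb hb' h h'
      rfl
    · intro α
      obtain ⟨d, u, h⟩ := exists_mem α
      obtain ⟨a, ha, b, hb, rfl⟩ := Submodule.mem_sup.mp
        (hcompl.sup_eq_top ▸ Submodule.mem_top : d ∈ A ⊔ B₀)
      have hsub := F.sub_mem h (hσ ⟨a, ha⟩)
      simp only [Prod.mk_sub_mk, add_sub_cancel_left, sub_zero] at hsub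
      exact ⟨⟨(b, u - σ ⟨a, ha⟩, α), hsub, hb, trivial⟩, rfl⟩
  let s := (LinearEquiv.ofBijective p hp).symm
  let τ : Module.Dual ℝ V →ₗ[ℝ] D := LinearMap.fst ℝ D _ ∘ₗ Submodule.subtype _ ∘ₗ s.toLinearMap
  let ρ : Module.Dual ℝ V →ₗ[ℝ] V := LinearMap.fst ℝ V (Module.Dual ℝ V) ∘ₗ
    LinearMap.snd ℝ D _ ∘ₗ Submodule.subtype _ ∘ₗ s.toLinearMap
  have hτ : ∀ α, τ α ∈ B₀ := fun α => (s α).2.2.1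
  have hτρ : ∀ α, (τ α, ρ α, α) ∈ F := by
    intro α
    have hs : (s α).1.2.2 = α := (LinearEquiv.ofBijective p hp).apply_symm_apply α
    have hmem : ((s α).1.1, (s α).1.2.1, (s α).1.2.2) ∈ F := (s α).2.1
    rw [hs] at hmem
    exact hmem
  refine ⟨τ, ρ, hτ, ?_, ?_, ?_, ?_⟩
  · ext ⟨d, u, α⟩
    constructor
    · intro h
      have hsub := F.sub_mem h (hτρ α)
      simp only [Prod.mk_sub_mk, sub_self] at hsub
      have ha : d - τ α ∈ A := (hFii _).mpr ⟨_, hsub⟩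
      have hu := uniq _ _ _ _ hsub (hσ ⟨_, ha⟩)
      refine ⟨⟨_, ha⟩, α, ?_⟩
      rw [← hu, sub_add_cancel, sub_add_cancel]
    · rintro ⟨a, β, h⟩
      rw [h]
      simpa using F.add_mem (hσ a) (hτρ β)
  · intro α a
    have h := isotropic _ (hτρ α) _ (hσ a)
    simp only [pairE, LinearMap.zero_apply, add_zero] at h
    linarith
  · intro α β
    have h := isotropic _ (hτρ α) _ (hτρ β)
    simp only [pairE, hB₀iso _ (hτ α) _ (hτ β)] at h
    linarith
  · intro τ' ρ' hτ' hF'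
    have hσ0 : σ 0 = 0 := hFi _ (hσ 0)
    have key : ∀ α, τ' α = τ α ∧ ρ' α = ρ α := by
      intro α
      have h : (τ' α, ρ' α, α) ∈ F := by
        rw [← SetLike.mem_coe, hF']
        exact ⟨0, α, by simp [hσ0]⟩
      exact uniq_of_mem _ _ _ _ α (hτ' α) (hτ α) h (hτρ α)
    exact ⟨LinearMap.ext fun α => (key α).1, LinearMap.ext fun α => (key α).2⟩
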